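/- The quartic polynomial χ₂(r) = 4r⁴ + 8r³ + 6r² - 18r - 81 has exactly one positive real root, and this root lies in the open interval (1.829, 1.830). -/

import Mathlib

/-- The quartic polynomial arising in the face and volume problems for isohedral
triakis octahedra. -/
noncomputable def χ₂ (r : ℝ) : ℝ :=
  4 * r ^ 4 + 8 * r ^ 3 + 6 * r ^ 2 - 18 * r - 81

/-- Dividing by the variable makes `χ₂` strictly increasing on the positive reals, so it has at
most one positive root. -/
theorem χ₂_eq_of_pos_of_eq_zero {x y : ℝ} (hx : 0 < x) (hy : 0 < y)
    (hχx : χ₂ x = 0) (hχy : χ₂ y = 0) : y = x := by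
  have key : (y - x) * (4 * (x * y) * (x ^ 2 + x * y + y ^ 2) + 8 * (x * y) * (x + y)
      + 6 * (x * y) + 81) = 0 := by
    unfold χ₂ at hχx hχy
    linear_combination x * hχy - y * hχx
  exact sub_eq_zero.mp ((mul_eq_zero.mp key).resolve_right (by positivity))

theorem quartic_unique_positive_root :
    ∃ x : ℝ, (0 < x ∧ χ₂ x = 0) ∧ (∀ y : ℝ, 0 < y → χ₂ y = 0 → y = x) ∧
      1.829 < x ∧ x < 1.830 := by
  have hcont : Continuous χ₂ := by
    unfold χ₂
    fun_prop
  obtain ⟨x, ⟨hl, hr⟩, hx⟩ := intermediate_value_Ioo (show (1.829 : ℝ) ≤ 1.830 by norm_num)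
    hcont.continuousOn (show (0 : ℝ) ∈ Set.Ioo (χ₂ 1.829) (χ₂ 1.830) by
      constructor <;> norm_num [χ₂])
  have hpos : 0 < x := lt_trans (by norm_num) hl
  exact ⟨x, ⟨hpos, hx⟩, fun y hy h => χ₂_eq_of_pos_of_eq_zero hpos hy hx h, hl, hr⟩
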